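/- arXiv:2212.14253 — 2 statements merged into one kernel-verified Lean document; each statement's English description precedes it below -/
import Mathlib

section
/- Let H(q,p) = ½ pᵀ M(q)⁻¹ p + V(q) be the Hamiltonian of an n-degree-of-freedom conservative mechanical system, with M smooth, symmetric positive definite valued and V smooth, and assume the associated Hamiltonian vector field is continuously differentiable (so solutions of initial value problems are unique). If q, p : ℝ → ℝⁿ solve Hamilton's equations q' = ∂H/∂p, p' = −∂H/∂q, satisfy p(0) = 0, and are periodic with period T > 0 (i.e. q(t+T) = q(t) and p(t+T) = p(t) for all t), then p(T/2) = 0. -/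
open Matrix

/-- The vector of partial derivatives of `f` at `x` (the gradient in coordinates). -/
noncomputable def pderivVec {n : ℕ} (f : (Fin n → ℝ) → ℝ) (x : Fin n → ℝ) : Fin n → ℝ :=
  fun i => fderiv ℝ f x (Pi.single i 1)

/-- Two global solutions of an autonomous ODE with a `C¹` right-hand side that agree at one time
agree at all times. -/
theorem ContDiff.eq_of_hasDerivAt_of_eq {E : Type*} [NormedAddCommGroup E] [NormedSpace ℝ E]
    {v : E → E} (hv : ContDiff ℝ 1 v) {f g : ℝ → E}
    (hf : ∀ t, HasDerivAt f (v (f t)) t) (hg : ∀ t, HasDerivAt g (v (g t)) t)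
    {t₀ : ℝ} (h : f t₀ = g t₀) : f = g := by
  have hfc : Continuous f := continuous_iff_continuousAt.2 fun t => (hf t).continuousAt
  have hgc : Continuous g := continuous_iff_continuousAt.2 fun t => (hg t).continuousAt
  have hopen : IsOpen {t | f t = g t} := by
    refine isOpen_iff_mem_nhds.2 fun t ht => ?_
    replace ht : f t = g t := ht
    obtain ⟨K, s, hs, hK⟩ := hv.contDiffAt.exists_lipschitzOnWith (x := f t)
    exact ODE_solution_unique_of_eventually (v := fun _ => v) (s := fun _ => s)
      (Filter.Eventually.of_forall fun _ => hK)
      ((hfc.continuousAt.eventually_mem hs).mono fun u hu => ⟨hf u, hu⟩)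
      ((hgc.continuousAt.eventually_mem (ht ▸ hs)).mono fun u hu => ⟨hg u, hu⟩) ht
  have huniv := IsClopen.eq_univ ⟨isClosed_eq hfc hgc, hopen⟩ ⟨t₀, h⟩
  exact funext fun t => huniv.ge (Set.mem_univ t)

/-- The gradient of an even function is odd. -/
theorem pderivVec_neg {n : ℕ} {f : (Fin n → ℝ) → ℝ} (hf : ∀ x, f (-x) = f x) (x : Fin n → ℝ) :
    pderivVec f (-x) = -pderivVec f x := by
  have h := (ContinuousLinearEquiv.neg ℝ (M := Fin n → ℝ)).comp_right_fderiv (f := f) (x := x)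
  rw [show f ∘ ContinuousLinearEquiv.neg ℝ = f from funext fun y => by simp [hf]] at h
  ext i
  simp [pderivVec, h]

/-- Lemma 2: a periodic solution (period `T > 0`) of Hamilton's equations for the
mechanical Hamiltonian `H(q,p) = ½ pᵀ M(q)⁻¹ p + V(q)` with `p(0) = 0` satisfies
`p(T/2) = 0`. -/
theorem periodic_zero_momentum_half_way {n : ℕ}
    (M : (Fin n → ℝ) → Matrix (Fin n) (Fin n) ℝ)
    (hMsmooth : ∀ i j, ContDiff ℝ (⊤ : ℕ∞) fun q => M q i j)
    (hMsymm : ∀ q, (M q).IsSymm)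
    (hMpd : ∀ q, (M q).PosDef)
    (V : (Fin n → ℝ) → ℝ) (hV : ContDiff ℝ (⊤ : ℕ∞) V)
    (H : (Fin n → ℝ) → (Fin n → ℝ) → ℝ)
    (hH : ∀ q p, H q p = (1 / 2 : ℝ) * (p ⬝ᵥ ((M q)⁻¹).mulVec p) + V q)
    -- the Hamiltonian vector field is continuously differentiable
    (hX : ContDiff ℝ 1 (fun x : (Fin n → ℝ) × (Fin n → ℝ) =>
      (pderivVec (fun p' => H x.1 p') x.2, -pderivVec (fun q' => H q' x.2) x.1)))
    (q p : ℝ → Fin n → ℝ)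
    (hq : ∀ t, HasDerivAt q (pderivVec (fun p' => H (q t) p') (p t)) t)
    (hp : ∀ t, HasDerivAt p (-pderivVec (fun q' => H q' (p t)) (q t)) t)
    (hp0 : p 0 = 0)
    (T : ℝ) (hT : 0 < T)
    (hqT : ∀ t, q (t + T) = q t) (hpT : ∀ t, p (t + T) = p t) :
    p (T / 2) = 0 := by
  have hHneg : ∀ a b, H a (-b) = H a b := fun a b => by simp [hH, mulVec_neg]
  have hrev := hX.eq_of_hasDerivAt_of_eq (t₀ := 0)
    (f := fun t => (q t, p t)) (g := fun t => (q (-t), -p (-t)))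
    (fun t => (hq t).prodMk (hp t))
    (fun t => by
      have hq' := (hq (-t)).scomp t (hasDerivAt_neg t)
      have hp' := ((hp (-t)).scomp t (hasDerivAt_neg t)).neg
      simp only [neg_smul, one_smul, neg_neg] at hq' hp'
      simp only [pderivVec_neg (hHneg _), hHneg]
      exact hq'.prodMk hp')
    (by simp [hp0])
  have h₁ : p (T / 2) = -p (-(T / 2)) := congrArg Prod.snd (congrFun hrev (T / 2))
  have h₂ : p (T / 2) = p (-(T / 2)) := by
    rw [← hpT (-(T / 2))]
    congr 1
    ring
  rw [← h₂] at h₁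
  exact self_eq_neg.1 h₁
end

section
/- Let M : ℝⁿ → (n×n real matrices) be smooth with symmetric positive definite values, V : ℝⁿ → ℝ smooth, and E(q,p) = ½ pᵀ M(q)⁻¹ p + V(q). Let q, p : ℝ → ℝⁿ be differentiable and satisfy q' = ∂E/∂p, p' = −∂E/∂q + u_E + u_M, where at each time t with p(t) ≠ 0: u_E = α_E (Ē − E(q,p)) · p/√(pᵀ M(q)⁻¹ p) with α_E > 0 and Ē ∈ ℝ, and u_M = α_M π_p(Y) for some Y ∈ ℝⁿ, α_M > 0, with π_p(Y) = Y − ((pᵀ M(q)⁻¹ Y)/(pᵀ M(q)⁻¹ p)) p. Then at every such time t, d/dt E(q(t),p(t)) = α_E (Ē − E(q(t),p(t))) √(p(t)ᵀ M(q(t))⁻¹ p(t)). -/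
open Matrix

theorem pderivVec_dotProduct {n : ℕ} (f : (Fin n → ℝ) → ℝ) (x v : Fin n → ℝ) :
    pderivVec f x ⬝ᵥ v = fderiv ℝ f x v := by
  conv_rhs => rw [← Finset.univ_sum_single v, map_sum]
  refine Finset.sum_congr rfl fun i _ => ?_
  have h : Pi.single i (v i) = v i • (Pi.single i 1 : Fin n → ℝ) := by
    rw [← Pi.single_smul]; simp
  rw [h, map_smul, smul_eq_mul, mul_comm, pderivVec]

theorem Matrix.differentiable_det {n : ℕ} {F : Type*} [NormedAddCommGroup F] [NormedSpace ℝ F]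
    {A : F → Matrix (Fin n) (Fin n) ℝ} (hA : ∀ i j, Differentiable ℝ fun x => A x i j) :
    Differentiable ℝ fun x => (A x).det := by
  simp only [Matrix.det_apply']
  refine Differentiable.fun_sum fun σ _ => Differentiable.const_mul (fun x => ?_) _
  exact (HasFDerivAt.finsetProd fun i _ => (hA (σ i) i x).hasFDerivAt).differentiableAt

theorem Matrix.differentiable_inv_apply {n : ℕ} {F : Type*} [NormedAddCommGroup F]
    [NormedSpace ℝ F] {A : F → Matrix (Fin n) (Fin n) ℝ}
    (hA : ∀ i j, Differentiable ℝ fun x => A x i j) (hdet : ∀ x, (A x).det ≠ 0) (i j : Fin n) :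
    Differentiable ℝ fun x => (A x)⁻¹ i j := by
  have hadj : Differentiable ℝ fun x => (A x).adjugate i j := by
    simp only [Matrix.adjugate_apply]
    refine Matrix.differentiable_det fun a b => ?_
    by_cases h : a = j
    · subst h
      simp
    · simpa [Matrix.updateRow_ne h] using hA a b
  simp only [Matrix.inv_def, Ring.inverse_eq_inv', Matrix.smul_apply, smul_eq_mul]
  exact ((Matrix.differentiable_det hA).fun_inv hdet).mul hadj

theorem Matrix.differentiable_dotProduct_mulVec {n : ℕ} {F : Type*} [NormedAddCommGroup F]
    [NormedSpace ℝ F] {A : F → Matrix (Fin n) (Fin n) ℝ} {v w : F → Fin n → ℝ}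
    (hA : ∀ i j, Differentiable ℝ fun x => A x i j) (hv : Differentiable ℝ v)
    (hw : Differentiable ℝ w) : Differentiable ℝ fun x => v x ⬝ᵥ A x *ᵥ w x := by
  simp only [dotProduct, Matrix.mulVec]
  fun_prop

theorem Matrix.IsSymm.dotProduct_mulVec_comm {n : ℕ} {A : Matrix (Fin n) (Fin n) ℝ}
    (hA : A.IsSymm) (v w : Fin n → ℝ) : v ⬝ᵥ A *ᵥ w = w ⬝ᵥ A *ᵥ v := by
  rw [Matrix.dotProduct_mulVec, ← Matrix.mulVec_transpose, hA.eq, dotProduct_comm]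

/-- The gradient of the quadratic form `½ xᵀ A x + c` of a symmetric matrix is `A x`. -/
theorem pderivVec_half_quadratic {n : ℕ} {A : Matrix (Fin n) (Fin n) ℝ} (hA : A.IsSymm)
    (c : ℝ) (x : Fin n → ℝ) :
    pderivVec (fun y => (1 / 2 : ℝ) * (y ⬝ᵥ A *ᵥ y) + c) x = A *ᵥ x := by
  have hline (v : Fin n → ℝ) :
      HasDerivAt (fun s : ℝ => (1 / 2 : ℝ) * ((x + s • v) ⬝ᵥ A *ᵥ (x + s • v)) + c)
        (v ⬝ᵥ A *ᵥ x) 0 := by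
    have hexp : (fun s : ℝ => (1 / 2 : ℝ) * ((x + s • v) ⬝ᵥ A *ᵥ (x + s • v)) + c) =
        fun s : ℝ => (1 / 2 : ℝ) * (x ⬝ᵥ A *ᵥ x) + c + s * (v ⬝ᵥ A *ᵥ x) +
          s ^ 2 * ((1 / 2 : ℝ) * (v ⬝ᵥ A *ᵥ v)) := by
      funext s
      simp only [Matrix.mulVec_add, Matrix.mulVec_smul, add_dotProduct, dotProduct_add,
        smul_dotProduct, dotProduct_smul, smul_eq_mul, hA.dotProduct_mulVec_comm x v]
      ring
    rw [hexp]
    simpa [Pi.add_def] using (((hasDerivAt_id (0 : ℝ)).mul_const (v ⬝ᵥ A *ᵥ x)).const_add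
      ((1 / 2 : ℝ) * (x ⬝ᵥ A *ᵥ x) + c)).add
      (((hasDerivAt_id (0 : ℝ)).fun_pow 2).mul_const ((1 / 2 : ℝ) * (v ⬝ᵥ A *ᵥ v)))
  have hdiff : Differentiable ℝ fun y : Fin n → ℝ => (1 / 2 : ℝ) * (y ⬝ᵥ A *ᵥ y) + c :=
    ((Matrix.differentiable_dotProduct_mulVec (fun i j => differentiable_const (A i j))
      differentiable_id differentiable_id).const_mul _).add_const c
  funext i
  have h : lineDeriv ℝ (fun y => (1 / 2 : ℝ) * (y ⬝ᵥ A *ᵥ y) + c) x (Pi.single i 1) =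
      Pi.single i 1 ⬝ᵥ A *ᵥ x := (hline (Pi.single i 1)).deriv
  rw [(hdiff x).lineDeriv_eq_fderiv] at h
  simpa [pderivVec] using h

/-- The rate of a function of two variables along a controlled Hamiltonian trajectory is the
power injected by the input. -/
theorem hasDerivAt_hamiltonian {n : ℕ} {E : (Fin n → ℝ) → (Fin n → ℝ) → ℝ}
    (q p : ℝ → Fin n → ℝ) (u : Fin n → ℝ) (t : ℝ)
    (hE : DifferentiableAt ℝ (fun z : (Fin n → ℝ) × (Fin n → ℝ) => E z.1 z.2) (q t, p t))
    (hq : HasDerivAt q (pderivVec (fun p' => E (q t) p') (p t)) t)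
    (hp : HasDerivAt p (-pderivVec (fun q' => E q' (p t)) (q t) + u) t) :
    HasDerivAt (fun s => E (q s) (p s)) (u ⬝ᵥ pderivVec (fun p' => E (q t) p') (p t)) t := by
  have h1 := HasFDerivAt.comp (q t) hE.hasFDerivAt
    (hasFDerivAt_prodMk_left (𝕜 := ℝ) (q t) (p t))
  have h2 := HasFDerivAt.comp (p t) hE.hasFDerivAt
    (hasFDerivAt_prodMk_right (𝕜 := ℝ) (q t) (p t))
  have h := hE.hasFDerivAt.comp_hasDerivAt t (hq.prodMk hp)
  have e1 (v : Fin n → ℝ) := (pderivVec_dotProduct _ _ v).trans (congrArg (· v) h1.fderiv)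
  have e2 (v : Fin n → ℝ) := (pderivVec_dotProduct _ _ v).trans (congrArg (· v) h2.fderiv)
  simp only [Function.comp_def, ContinuousLinearMap.comp_apply, ContinuousLinearMap.inl_apply,
    ContinuousLinearMap.inr_apply] at e1 e2
  refine h.congr_deriv ?_
  set a := pderivVec (fun q' => E q' (p t)) (q t)
  set b := pderivVec (fun p' => E (q t) p') (p t)
  have hsplit : (b, -a + u) = ((b, 0) : (Fin n → ℝ) × (Fin n → ℝ)) + (0, -a + u) := by simp
  rw [hsplit, map_add, ← e1, ← e2, dotProduct_add, dotProduct_neg, dotProduct_comm b a,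
    dotProduct_comm b u]
  ring

/-- Closed-loop energy dynamics: for the mechanical energy
`E(q,p) = ½ pᵀ M(q)⁻¹ p + V(q)` and the controlled Hamiltonian system
`q' = ∂E/∂p`, `p' = −∂E/∂q + u_E + u_M`, where at each time with `p(t) ≠ 0` the
energy feedback is `u_E = α_E (Ē − E) p/√(pᵀ M⁻¹ p)` and the mode feedback is
`u_M = α_M π_p(Y)` for some `Y`, the energy satisfies
`d/dt E(q(t),p(t)) = α_E (Ē − E(q(t),p(t))) √(p(t)ᵀ M(q(t))⁻¹ p(t))`. -/
theorem closed_loop_energy_rate {n : ℕ}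
    (M : (Fin n → ℝ) → Matrix (Fin n) (Fin n) ℝ)
    (hMsmooth : ∀ i j, ContDiff ℝ (⊤ : ℕ∞) fun q => M q i j)
    (hMsymm : ∀ q, (M q).IsSymm)
    (hMpd : ∀ q, (M q).PosDef)
    (V : (Fin n → ℝ) → ℝ) (hV : ContDiff ℝ (⊤ : ℕ∞) V)
    (E : (Fin n → ℝ) → (Fin n → ℝ) → ℝ)
    (hE : ∀ q p, E q p = (1 / 2 : ℝ) * (p ⬝ᵥ ((M q)⁻¹).mulVec p) + V q)
    (αE αM Ebar : ℝ) (hαE : 0 < αE) (hαM : 0 < αM)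
    (uE uM : ℝ → Fin n → ℝ)
    (q p : ℝ → Fin n → ℝ)
    (hq : ∀ t, HasDerivAt q (pderivVec (fun p' => E (q t) p') (p t)) t)
    (hp : ∀ t, HasDerivAt p
      (-pderivVec (fun q' => E q' (p t)) (q t) + uE t + uM t) t)
    (huE : ∀ t, p t ≠ 0 → uE t = (αE * (Ebar - E (q t) (p t))) •
      ((Real.sqrt (p t ⬝ᵥ ((M (q t))⁻¹).mulVec (p t)))⁻¹ • p t))
    (huM : ∀ t, p t ≠ 0 → ∃ Y : Fin n → ℝ, uM t = αM •
      (Y - ((p t ⬝ᵥ ((M (q t))⁻¹).mulVec Y) /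
            (p t ⬝ᵥ ((M (q t))⁻¹).mulVec (p t))) • p t)) :
    ∀ t : ℝ, p t ≠ 0 → HasDerivAt (fun s => E (q s) (p s))
      (αE * (Ebar - E (q t) (p t)) *
        Real.sqrt (p t ⬝ᵥ ((M (q t))⁻¹).mulVec (p t))) t := by
  intro t ht
  have hMdiff : ∀ i j, Differentiable ℝ fun q => M q i j := fun i j =>
    (hMsmooth i j).differentiable (by simp)
  have hdiff : Differentiable ℝ fun z : (Fin n → ℝ) × (Fin n → ℝ) => E z.1 z.2 := by
    have hinv (i j : Fin n) :
        Differentiable ℝ fun z : (Fin n → ℝ) × (Fin n → ℝ) => (M z.1)⁻¹ i j :=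
      (Matrix.differentiable_inv_apply hMdiff (fun x => (hMpd x).det_pos.ne') i j).comp
        differentiable_fst
    have hV' : Differentiable ℝ V := hV.differentiable (by simp)
    simp only [hE]
    exact ((Matrix.differentiable_dotProduct_mulVec hinv differentiable_snd
      differentiable_snd).const_mul _).add (hV'.comp differentiable_fst)
  have hsymm : ((M (q t))⁻¹).IsSymm := by
    rw [Matrix.IsSymm, Matrix.transpose_nonsing_inv, (hMsymm (q t)).eq]
  have hgrad : pderivVec (fun p' => E (q t) p') (p t) = (M (q t))⁻¹ *ᵥ p t := by
    simp only [hE]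
    exact pderivVec_half_quadratic hsymm _ _
  have hpos : 0 < p t ⬝ᵥ (M (q t))⁻¹ *ᵥ p t := by
    simpa using (hMpd (q t)).inv.dotProduct_mulVec_pos ht
  have hp' := hp t
  rw [add_assoc] at hp'
  refine (hasDerivAt_hamiltonian q p _ t (hdiff _) (hq t) hp').congr_deriv ?_
  obtain ⟨Y, hY⟩ := huM t ht
  have hpower : uM t ⬝ᵥ (M (q t))⁻¹ *ᵥ p t = 0 := by
    rw [hY, smul_dotProduct, sub_dotProduct, smul_dotProduct, hsymm.dotProduct_mulVec_comm Y,
      smul_eq_mul, smul_eq_mul, div_mul_cancel₀ _ hpos.ne', sub_self, mul_zero]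
  rw [hgrad, add_dotProduct, hpower, add_zero, huE t ht, smul_dotProduct, smul_dotProduct,
    smul_eq_mul, smul_eq_mul, inv_mul_eq_div, Real.div_sqrt]
end
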